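/- arXiv:1112.3097 — 3 statements merged into one kernel-verified Lean document; each statement's English description precedes it below -/
import Mathlib

section
/- Let F be a field of characteristic ℓ > 0 and let G be a group. Let ρ and ρ' be two n-dimensional semisimple representations of G over F, and assume ℓ > n. If for every g ∈ G the characteristic polynomial of ρ(g) equals the characteristic polynomial of ρ'(g), then ρ and ρ' are isomorphic. -/
section TraceModule

variable {F A : Type*} [Field F] [Ring A] [Algebra F A]

theorem trace_lsmul_eq_of_linearEquiv {M N : Type*}
    [AddCommGroup M] [Module F M] [Module A M] [IsScalarTower F A M]
    [AddCommGroup N] [Module F N] [Module A N] [IsScalarTower F A N]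
    (e : M ≃ₗ[A] N) (a : A) :
    LinearMap.trace F M (Algebra.lsmul F F M a) =
      LinearMap.trace F N (Algebra.lsmul F F N a) := by
  rw [← LinearMap.trace_conj' _ (e.restrictScalars F)]
  congr 1
  ext x
  simp [LinearEquiv.conj_apply]

theorem trace_lsmul_prod {M N : Type*}
    [AddCommGroup M] [Module F M] [Module A M] [IsScalarTower F A M] [FiniteDimensional F M]
    [AddCommGroup N] [Module F N] [Module A N] [IsScalarTower F A N] [FiniteDimensional F N]
    (a : A) :
    LinearMap.trace F (M × N) (Algebra.lsmul F F (M × N) a) =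
      LinearMap.trace F M (Algebra.lsmul F F M a) +
        LinearMap.trace F N (Algebra.lsmul F F N a) := by
  rw [← LinearMap.trace_prodMap']
  congr 1

theorem trace_lsmul_add_of_isCompl {M : Type*}
    [AddCommGroup M] [Module F M] [Module A M] [IsScalarTower F A M] [FiniteDimensional F M]
    {P Q : Submodule A M} (h : IsCompl P Q) (a : A) :
    LinearMap.trace F M (Algebra.lsmul F F M a) =
      LinearMap.trace F P (Algebra.lsmul F F P a) +
        LinearMap.trace F Q (Algebra.lsmul F F Q a) := by
  have : FiniteDimensional F P := inferInstanceAs (FiniteDimensional F (P.restrictScalars F))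
  have : FiniteDimensional F Q := inferInstanceAs (FiniteDimensional F (Q.restrictScalars F))
  rw [← trace_lsmul_prod, trace_lsmul_eq_of_linearEquiv (P.prodEquivOfIsCompl Q h)]

theorem IsSemisimpleModule.prod {M N : Type*} [AddCommGroup M] [Module A M] [AddCommGroup N]
    [Module A N] [IsSemisimpleModule A M] [IsSemisimpleModule A N] :
    IsSemisimpleModule A (M × N) := by
  have h : IsSemisimpleModule A
      ↥(LinearMap.range (LinearMap.inl A M N) ⊔ LinearMap.range (LinearMap.inr A M N)) :=
    .sup (.range _) (.range _)
  rw [LinearMap.sup_range_inl_inr] at h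
  exact .congr Submodule.topEquiv.symm

/-- If there are no nonzero homomorphisms between two semisimple modules in either direction, then
some ring element acts as the identity on the first and as zero on the second. -/
theorem exists_smul_eq_self_and_smul_eq_zero {M N : Type*}
    [AddCommGroup M] [Module F M] [Module A M] [IsScalarTower F A M] [FiniteDimensional F M]
    [AddCommGroup N] [Module F N] [Module A N] [IsScalarTower F A N] [FiniteDimensional F N]
    [IsSemisimpleModule A M] [IsSemisimpleModule A N]
    (hMN : ∀ f : M →ₗ[A] N, f = 0) (hNM : ∀ f : N →ₗ[A] M, f = 0) :
    ∃ a : A, (∀ x : M, a • x = x) ∧ ∀ y : N, a • y = 0 := by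
  classical
  have := IsSemisimpleModule.prod (A := A) (M := M) (N := N)
  let p : Module.End (Module.End A (M × N)) (M × N) :=
    { toFun := fun x ↦ (x.1, 0)
      map_add' := fun x y ↦ by simp
      map_smul' := fun g x ↦ by
        have h₁ := LinearMap.congr_fun (hMN (LinearMap.snd A M N ∘ₗ g ∘ₗ LinearMap.inl A M N)) x.1
        have h₂ := LinearMap.congr_fun (hNM (LinearMap.fst A M N ∘ₗ g ∘ₗ LinearMap.inr A M N)) x.2
        have hx : g x = g (x.1, 0) + g (0, x.2) := by rw [← map_add]; simp
        simp only [LinearMap.comp_apply, LinearMap.inl_apply, LinearMap.inr_apply,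
          LinearMap.fst_apply, LinearMap.snd_apply, LinearMap.zero_apply] at h₁ h₂
        ext <;> simp [hx, h₁, h₂] }
  let b := Module.finBasis F M
  let c := Module.finBasis F N
  obtain ⟨a, ha⟩ := jacobson_density p
    (Finset.univ.image (fun i ↦ (b i, (0 : N))) ∪ Finset.univ.image (fun i ↦ ((0 : M), c i)))
  refine ⟨a, fun x ↦ ?_, fun y ↦ ?_⟩
  · refine LinearMap.congr_fun (b.ext (f₁ := Algebra.lsmul F F M a) (f₂ := LinearMap.id)
      fun i ↦ ?_) x
    simpa [p] using (congrArg Prod.fst (ha (b i, 0) (by simp))).symm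
  · refine LinearMap.congr_fun (c.ext (f₁ := Algebra.lsmul F F N a) (f₂ := 0) fun i ↦ ?_) y
    simpa [p] using (congrArg Prod.snd (ha (0, c i) (by simp))).symm

theorem exists_isCompl_linearEquiv_of_ne_zero {M N : Type*} [AddCommGroup M] [Module A M]
    [AddCommGroup N] [Module A N] [IsSemisimpleModule A M] [IsSemisimpleModule A N]
    {f : M →ₗ[A] N} (hf : f ≠ 0) :
    ∃ (P Q : Submodule A M) (P' Q' : Submodule A N), IsCompl P Q ∧ IsCompl P' Q' ∧
      P ≠ ⊥ ∧ Nonempty (P ≃ₗ[A] P') := by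
  obtain ⟨P, hP⟩ := exists_isCompl (LinearMap.ker f)
  obtain ⟨Q', hQ'⟩ := exists_isCompl (LinearMap.range f)
  refine ⟨P, _, _, Q', hP.symm, hQ', ?_,
    ⟨(Submodule.quotientEquivOfIsCompl _ _ hP).symm.trans f.quotKerEquivRange⟩⟩
  rintro rfl
  exact hf (LinearMap.ker_eq_top.mp (by simpa using hP.sup_eq_top))

/-- Semisimple modules over an algebra whose dimensions are below the characteristic of the base
field are determined by their trace functions. -/
theorem nonempty_linearEquiv_of_trace_lsmul_eq {ℓ : ℕ} [CharP F ℓ] (d : ℕ) {M N : Type*}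
    [AddCommGroup M] [Module F M] [Module A M] [IsScalarTower F A M] [FiniteDimensional F M]
    [AddCommGroup N] [Module F N] [Module A N] [IsScalarTower F A N] [FiniteDimensional F N]
    [IsSemisimpleModule A M] [IsSemisimpleModule A N]
    (hd : Module.finrank F M = d) (hM : d < ℓ) (hN : Module.finrank F N < ℓ)
    (htr : ∀ a : A, LinearMap.trace F M (Algebra.lsmul F F M a) =
      LinearMap.trace F N (Algebra.lsmul F F N a)) :
    Nonempty (M ≃ₗ[A] N) := by
  induction d using Nat.strong_induction_on generalizing M N with
  | _ d ih =>
  by_cases hcase : ∃ (P Q : Submodule A M) (P' Q' : Submodule A N), IsCompl P Q ∧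
      IsCompl P' Q' ∧ P ≠ ⊥ ∧ Nonempty (P ≃ₗ[A] P')
  · obtain ⟨P, Q, P', Q', h, h', hP, ⟨e⟩⟩ := hcase
    have : FiniteDimensional F Q := inferInstanceAs (FiniteDimensional F (Q.restrictScalars F))
    have : FiniteDimensional F Q' := inferInstanceAs (FiniteDimensional F (Q'.restrictScalars F))
    have hQlt : Module.finrank F Q < d := by
      rw [← hd]
      refine Submodule.finrank_lt (s := Q.restrictScalars F) fun hQ ↦ hP ?_
      rw [Submodule.restrictScalars_eq_top_iff] at hQ
      simpa [hQ] using h.inf_eq_bot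
    have hQ'le : Module.finrank F Q' ≤ Module.finrank F N :=
      Submodule.finrank_le (Q'.restrictScalars F)
    obtain ⟨e'⟩ := ih _ hQlt (M := Q) (N := Q') rfl (hQlt.trans hM) (hQ'le.trans_lt hN) fun a ↦ by
      have := htr a
      rw [trace_lsmul_add_of_isCompl h, trace_lsmul_add_of_isCompl h',
        trace_lsmul_eq_of_linearEquiv e] at this
      exact add_left_cancel this
    exact ⟨(P.prodEquivOfIsCompl Q h).symm ≪≫ₗ e.prodCongr e' ≪≫ₗ P'.prodEquivOfIsCompl Q' h'⟩
  · have hMN (f : M →ₗ[A] N) : f = 0 := by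
      by_contra hf
      exact hcase (exists_isCompl_linearEquiv_of_ne_zero hf)
    have hNM (f : N →ₗ[A] M) : f = 0 := by
      by_contra hf
      obtain ⟨P, Q, P', Q', h, h', hP, ⟨e⟩⟩ := exists_isCompl_linearEquiv_of_ne_zero hf
      refine hcase ⟨P', Q', P, Q, h', h, ?_, ⟨e.symm⟩⟩
      rintro rfl
      exact hP ((Submodule.subsingleton_iff_eq_bot).mp e.toEquiv.subsingleton)
    have hM0 : Subsingleton M := by
      obtain ⟨a, ha, ha'⟩ := exists_smul_eq_self_and_smul_eq_zero (F := F) hMN hNM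
      refine (Module.finrank_zero_iff (R := F)).mp (Nat.eq_zero_of_dvd_of_lt
        ((CharP.cast_eq_zero_iff F ℓ _).mp ?_) (hd ▸ hM))
      have h₁ : Algebra.lsmul F F M a = LinearMap.id := LinearMap.ext ha
      have h₂ : Algebra.lsmul F F N a = 0 := LinearMap.ext ha'
      simpa [h₁, h₂] using htr a
    have hN0 : Subsingleton N := by
      refine (Module.finrank_zero_iff (R := F)).mp (Nat.eq_zero_of_dvd_of_lt
        ((CharP.cast_eq_zero_iff F ℓ _).mp ?_) hN)
      simpa [Module.finrank_zero_of_subsingleton] using (htr 1).symm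
    exact ⟨0⟩

end TraceModule

theorem Representation.trace_lsmul_asModule_eq {F G V V' : Type*} [Field F] [Group G]
    [AddCommGroup V] [Module F V] [AddCommGroup V'] [Module F V']
    (ρ : Representation F G V) (ρ' : Representation F G V')
    (h : ∀ g, LinearMap.trace F V (ρ g) = LinearMap.trace F V' (ρ' g)) (a : MonoidAlgebra F G) :
    LinearMap.trace F ρ.asModule (Algebra.lsmul F F ρ.asModule a) =
      LinearMap.trace F ρ'.asModule (Algebra.lsmul F F ρ'.asModule a) := by
  change LinearMap.trace F V (ρ.asAlgebraHom a) = LinearMap.trace F V' (ρ'.asAlgebraHom a)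
  induction a using MonoidAlgebra.induction_on with
  | of g => simpa using h g
  | add a b ha hb => simp [ha, hb]
  | smul r a ha => simp [ha]


theorem LinearMap.trace_eq_neg_nextCoeff_charpoly {F V : Type*} [Field F] [AddCommGroup V]
    [Module F V] [FiniteDimensional F V] (f : V →ₗ[F] V) :
    LinearMap.trace F V f = -f.charpoly.nextCoeff := by
  rw [LinearMap.trace_eq_matrix_trace F (Module.finBasis F V),
    Matrix.trace_eq_neg_charpoly_nextCoeff, LinearMap.charpoly_toMatrix]

/-- **Brauer–Nesbitt in characteristic `ℓ > n`.**
Let `F` be a field of characteristic `ℓ > 0` and `G` a group. If `ρ` and `ρ'` are two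
`n`-dimensional semisimple representations of `G` over `F` with `ℓ > n`, and for every
`g ∈ G` the characteristic polynomials of `ρ g` and `ρ' g` agree, then `ρ` and `ρ'`
are isomorphic (as modules over the group algebra `F[G]`). -/
theorem stmt_0 {F G V V' : Type*} [Field F] [Group G]
    [AddCommGroup V] [Module F V] [FiniteDimensional F V]
    [AddCommGroup V'] [Module F V'] [FiniteDimensional F V']
    {n ℓ : ℕ} (hchar : CharP F ℓ) (hℓ : 0 < ℓ) (hn : n < ℓ)
    (ρ : Representation F G V) (ρ' : Representation F G V')
    (hdim : Module.finrank F V = n) (hdim' : Module.finrank F V' = n)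
    (hss : IsSemisimpleModule (MonoidAlgebra F G) ρ.asModule)
    (hss' : IsSemisimpleModule (MonoidAlgebra F G) ρ'.asModule)
    (hcp : ∀ g : G, (ρ g).charpoly = (ρ' g).charpoly) :
    Nonempty (ρ.asModule ≃ₗ[MonoidAlgebra F G] ρ'.asModule) := by
  refine nonempty_linearEquiv_of_trace_lsmul_eq (F := F) (ℓ := ℓ) n
    (ρ.asModuleEquiv.finrank_eq.trans hdim) hn
    ((ρ'.asModuleEquiv.finrank_eq.trans hdim').trans_lt hn)
    (ρ.trace_lsmul_asModule_eq ρ' fun g ↦ ?_)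
  rw [(ρ g).trace_eq_neg_nextCoeff_charpoly, (ρ' g).trace_eq_neg_nextCoeff_charpoly, hcp]
end

section
/- Let K be a field, let M be an n × n matrix over K, and suppose that every coefficient of the characteristic polynomial of M lies in the image of the canonical ring homomorphism ℤ → K. Then for every positive integer k, every coefficient of the characteristic polynomial of M^k lies in the image of ℤ → K. -/
open Polynomial in
/-- The determinant of a polynomial in a matrix whose polynomial splits is the resultant of the
characteristic polynomial with that polynomial. -/
theorem Matrix.det_aeval_eq_resultant_of_splits {R ι : Type*} [CommRing R] [IsDomain R] [Fintype ι]
    [DecidableEq ι] (M : Matrix ι ι R) {q : R[X]} (hq : q.Splits) :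
    (aeval M q).det = resultant M.charpoly q (Fintype.card ι) q.natDegree := by
  let φ : R[X] →* R := Matrix.detMonoidHom.comp (aeval M : R[X] →ₐ[R] Matrix ι ι R).toMonoidHom
  have hC (c : R) : φ (C c) = c ^ Fintype.card ι := by
    simp [φ, Matrix.algebraMap_eq_diagonal]
  have hX (r : R) : φ (X - C r) = (-1) ^ Fintype.card ι * M.charpoly.eval r := by
    rw [Matrix.eval_charpoly, ← Matrix.det_neg]
    simp [φ, Matrix.algebraMap_eq_diagonal, Pi.algebraMap_def]
  calc (aeval M q).det = φ q := rfl
    _ = φ (C q.leadingCoeff * (q.roots.map (X - C ·)).prod) := by rw [← hq.eq_prod_roots]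
    _ = q.leadingCoeff ^ Fintype.card ι *
        (((-1) ^ Fintype.card ι) ^ q.natDegree * (q.roots.map M.charpoly.eval).prod) := by
      simp [map_multiset_prod, Multiset.map_map, hC, hX, hq.natDegree_eq_card_roots]
    _ = _ := by
      rw [resultant_comm, resultant_eq_prod_eval _ _ _ M.charpoly_natDegree_eq_dim.le hq, pow_mul]
      ring

open Polynomial in
/-- The determinant of a polynomial in a matrix is the resultant of the characteristic polynomial
with that polynomial. -/
theorem Matrix.det_aeval_eq_resultant {R ι : Type*} [CommRing R] [IsDomain R] [Fintype ι]
    [DecidableEq ι] (M : Matrix ι ι R) (q : R[X]) :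
    (aeval M q).det = resultant M.charpoly q (Fintype.card ι) q.natDegree := by
  let L := AlgebraicClosure (FractionRing R)
  have hinj : Function.Injective (algebraMap R L) := by
    rw [IsScalarTower.algebraMap_eq R (FractionRing R) L]
    exact (algebraMap (FractionRing R) L).injective.comp (IsFractionRing.injective R _)
  apply hinj
  have hM : aeval (M.map (algebraMap R L)) (q.map (algebraMap R L)) =
      (aeval M q).map (algebraMap R L) := by
    rw [aeval_map_algebraMap]
    exact aeval_algHom_apply (Algebra.ofId R L).mapMatrix M q
  rw [← resultant_map_map, ← Matrix.charpoly_map, RingHom.map_det, RingHom.mapMatrix_apply, ← hM,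
    Matrix.det_aeval_eq_resultant_of_splits _ (IsAlgClosed.splits _),
    natDegree_map_eq_of_injective hinj]

open Polynomial in
/-- The characteristic polynomial of `M ^ k` is the resultant, in an auxiliary variable `Y`, of
the characteristic polynomial of `M` and `X - Y ^ k`. -/
theorem Matrix.charpoly_pow_eq_resultant {R ι : Type*} [CommRing R] [IsDomain R] [Fintype ι]
    [DecidableEq ι] (M : Matrix ι ι R) {k : ℕ} (hk : 0 < k) :
    (M ^ k).charpoly =
      resultant (M.charpoly.map C) (C X - X ^ k : R[X][X]) (Fintype.card ι) k := by
  have hdeg : (C X - X ^ k : R[X][X]).natDegree = k := by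
    rw [natDegree_sub_eq_right_of_natDegree_lt] <;> simp [hk]
  have hM : aeval (M.map C) (C X - X ^ k : R[X][X]) = Matrix.charmatrix (M ^ k) := by
    simp [Matrix.charmatrix, Matrix.algebraMap_eq_diagonal, Pi.algebraMap_def, map_pow]
  rw [Matrix.charpoly, ← hM, Matrix.det_aeval_eq_resultant, hdeg, Matrix.charpoly_map]


open Polynomial in
/-- If the characteristic polynomial of `M` lifts along a ring homomorphism, then so does that of
`M ^ k`. -/
theorem Matrix.charpoly_pow_mem_lifts {S R ι : Type*} [CommRing S] [CommRing R] [IsDomain R]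
    [Fintype ι] [DecidableEq ι] (f : S →+* R) (M : Matrix ι ι R) (hM : M.charpoly ∈ lifts f)
    {k : ℕ} (hk : 0 < k) : (M ^ k).charpoly ∈ lifts f := by
  obtain ⟨P, hP⟩ := (mem_lifts _).mp hM
  have hC : (mapRingHom f).comp C = C.comp f := by
    ext; simp
  have hY : (C X - X ^ k : S[X][X]).map (mapRingHom f) = C X - X ^ k := by
    simp
  refine (mem_lifts _).mpr
    ⟨resultant (P.map C) (C X - X ^ k : S[X][X]) (Fintype.card ι) k, ?_⟩
  rw [M.charpoly_pow_eq_resultant hk, ← hP, ← coe_mapRingHom f, ← resultant_map_map,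
    coe_mapRingHom, Polynomial.map_map, Polynomial.map_map, hC, hY]

/-- **Integrality of characteristic polynomials of powers of a matrix.**
Let `K` be a field and `M` an `n × n` matrix over `K` whose characteristic polynomial has
all coefficients in the image of the canonical ring homomorphism `ℤ → K`. Then for every
positive integer `k`, every coefficient of the characteristic polynomial of `M ^ k` also
lies in the image of `ℤ → K`. -/
theorem stmt_6 {K : Type*} [Field K] {n : ℕ} (M : Matrix (Fin n) (Fin n) K)
    (h : ∀ i : ℕ, M.charpoly.coeff i ∈ Set.range (Int.cast : ℤ → K)) :
    ∀ k : ℕ, 0 < k → ∀ i : ℕ, (M ^ k).charpoly.coeff i ∈ Set.range (Int.cast : ℤ → K) := by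
  intro k hk
  exact (Polynomial.lifts_iff_coeff_lifts (f := Int.castRingHom K) _).mp
    (M.charpoly_pow_mem_lifts _ ((Polynomial.lifts_iff_coeff_lifts _).mpr h) hk)
end

section
/- Let F be a field, G a group, and V a finite-dimensional semisimple representation of G over F via ρ : G → GL(V), and assume the image ρ(G) ⊆ GL(V) is commutative. Fix a positive integer k, and let ρ_k : G → GL(V) be the map defined by ρ_k(g) = (ρ(g))^k (this is a group homomorphism since ρ(G) is commutative). Then V is semisimple as a representation of G via ρ_k. -/
namespace Representation

variable {F G V : Type*} [Field F] [Group G] [AddCommGroup V] [Module F V]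

/-- Semisimplicity over the group algebra only depends on the image of the group algebra in the
endomorphism algebra. -/
theorem isSemisimpleModule_asModule_iff_range (ρ : Representation F G V) :
    IsSemisimpleModule (MonoidAlgebra F G) ρ.asModule ↔
      IsSemisimpleModule ρ.asAlgebraHom.range V := by
  let σ : MonoidAlgebra F G →+* ρ.asAlgebraHom.range := ρ.asAlgebraHom.rangeRestrict
  have : RingHomSurjective σ := ⟨ρ.asAlgebraHom.rangeRestrict_surjective⟩
  let e : ρ.asModule →ₛₗ[σ] V :=
    { ρ.asModuleEquiv.toAddMonoidHom with
      map_smul' := fun r x ↦ ρ.asModuleEquiv_map_smul r x }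
  exact e.isSemisimpleModule_iff_of_bijective ρ.asModuleEquiv.bijective

theorem commute_asAlgebraHom {ρ : Representation F G V} (hρ : ∀ g h : G, Commute (ρ g) (ρ h))
    (x y : MonoidAlgebra F G) : Commute (ρ.asAlgebraHom x) (ρ.asAlgebraHom y) := by
  induction x using MonoidAlgebra.induction_on with
  | of g =>
    induction y using MonoidAlgebra.induction_on with
    | of h => simpa only [asAlgebraHom_of] using hρ g h
    | add a b ha hb => simpa only [map_add] using ha.add_right hb
    | smul r a ha => simpa only [map_smul] using ha.smul_right r
  | add a b ha hb => simpa only [map_add] using ha.add_left hb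
  | smul r a ha => simpa only [map_smul] using ha.smul_left r

/-- A finite-dimensional representation with commutative image is semisimple if and only if the
image of the group algebra is reduced. -/
theorem isSemisimpleModule_asModule_iff_isReduced [FiniteDimensional F V]
    {ρ : Representation F G V} (hρ : ∀ g h : G, Commute (ρ g) (ρ h)) :
    IsSemisimpleModule (MonoidAlgebra F G) ρ.asModule ↔ IsReduced ρ.asAlgebraHom.range := by
  rw [isSemisimpleModule_asModule_iff_range]
  let : CommRing ρ.asAlgebraHom.range :=
    { (inferInstance : Ring ρ.asAlgebraHom.range) with
      mul_comm := by
        rintro ⟨_, x, rfl⟩ ⟨_, y, rfl⟩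
        exact Subtype.ext (commute_asAlgebraHom hρ x y) }
  refine ⟨fun _ ↦ ⟨fun b hb ↦ ?_⟩, fun _ ↦ ?_⟩
  · obtain ⟨n, hn⟩ := hb
    have hmem : b ∈ Module.annihilator ρ.asAlgebraHom.range V :=
      IsSemisimpleModule.annihilator_isRadical V ρ.asAlgebraHom.range
        ⟨n, by rw [hn]; exact zero_mem _⟩
    exact Subtype.ext (LinearMap.ext fun v ↦ Module.mem_annihilator.mp hmem v)
  · have : IsArtinianRing ρ.asAlgebraHom.range := IsArtinianRing.of_finite F _
    have : IsSemisimpleRing ρ.asAlgebraHom.range := IsArtinianRing.isSemisimpleRing_of_isReduced _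
    infer_instance

end Representation

/-- **Powers of an abelian semisimple representation are semisimple.**
Let `F` be a field, `G` a group, and `V` a finite-dimensional semisimple representation of
`G` over `F` via `ρ`, with `ρ(G)` commutative. If `k` is a positive integer and
`ρₖ : G → GL(V)` is the representation defined by `ρₖ g = (ρ g) ^ k`, then `V` is
semisimple as a representation of `G` via `ρₖ`. -/
theorem stmt_8 {F G V : Type*} [Field F] [Group G]
    [AddCommGroup V] [Module F V] [FiniteDimensional F V]
    (ρ : Representation F G V)
    (hcomm : ∀ g h : G, ρ g * ρ h = ρ h * ρ g)
    (hss : IsSemisimpleModule (MonoidAlgebra F G) ρ.asModule)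
    (k : ℕ) (hk : 0 < k)
    (ρk : Representation F G V) (hρk : ∀ g : G, ρk g = (ρ g) ^ k) :
    IsSemisimpleModule (MonoidAlgebra F G) ρk.asModule := by
  have hcommk (g h : G) : Commute (ρk g) (ρk h) := by
    rw [hρk, hρk]
    exact Commute.pow_pow (hcomm g h) k k
  rw [Representation.isSemisimpleModule_asModule_iff_isReduced hcomm] at hss
  rw [Representation.isSemisimpleModule_asModule_iff_isReduced hcommk]
  have hle : ρk.asAlgebraHom.range ≤ ρ.asAlgebraHom.range := by
    rintro _ ⟨x, rfl⟩
    change ρk.asAlgebraHom x ∈ ρ.asAlgebraHom.range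
    induction x using MonoidAlgebra.induction_on with
    | of g =>
      rw [Representation.asAlgebraHom_of, hρk]
      exact pow_mem (ρ.asAlgebraHom.mem_range.mpr ⟨_, ρ.asAlgebraHom_of g⟩) k
    | add a b ha hb => simpa only [map_add] using add_mem ha hb
    | smul r a ha => simpa only [map_smul] using Subalgebra.smul_mem _ ha r
  exact isReduced_of_injective (Subalgebra.inclusion hle) (Subalgebra.inclusion_injective hle)
end
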